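/- Sufficient condition for Hermitianness (ii): with the Hartwig–Spindelböck decomposition data as in the context and Â^N := Û · fromBlocks(K*Σ₁⁻¹, 0, L*Σ₁⁻¹, 0) · Û* (the NDMPI of Â), if Â·Â*·Â^N = Â, then Â is Hermitian (Â* = Â). -/

import Mathlib

open Matrix

/-- The dual complex numbers `𝔻ℂ := ℂ[ε]`, the trivial square-zero extension of `ℂ` by `ℂ`. -/
abbrev DC := TrivSqZeroExt ℂ ℂ

/-- Star on dual complex numbers: `(a + b·ε)* = conj a + conj b · ε`. -/
instance : Star DC :=
  ⟨fun x => ((starRingEnd ℂ) x.fst, (starRingEnd ℂ) x.snd)⟩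

/-- A positive appreciable real dual number: the standard part is a positive real and
the dual part is real. -/
def PosAppreciable (x : DC) : Prop :=
  (∃ a : ℝ, 0 < a ∧ x.fst = (a : ℂ)) ∧ (∃ b : ℝ, x.snd = (b : ℂ))

/-- A nonnegative infinitesimal real dual number: the standard part is `0` and
the dual part is a nonnegative real. -/
def NonnegInfinitesimal (x : DC) : Prop :=
  x.fst = 0 ∧ ∃ b : ℝ, 0 ≤ b ∧ x.snd = (b : ℂ)

/-- The standard part of a dual complex matrix. -/
def stdPart {m n : Type*} (X : Matrix m n DC) : Matrix m n ℂ :=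
  X.map TrivSqZeroExt.fst

/-- The dual part of a dual complex matrix. -/
def dualPart {m n : Type*} (X : Matrix m n DC) : Matrix m n ℂ :=
  X.map TrivSqZeroExt.snd

/-- Conjugation makes the dual complex numbers a star ring. -/
abbrev dcStarRing : StarRing DC where
  star_involutive x := TrivSqZeroExt.ext (Complex.conj_conj x.fst) (Complex.conj_conj x.snd)
  star_mul x y := by
    refine TrivSqZeroExt.ext ?_ ?_
    · change (starRingEnd ℂ) (x * y).fst = (starRingEnd ℂ) y.fst * (starRingEnd ℂ) x.fst
      rw [TrivSqZeroExt.fst_mul, map_mul, mul_comm]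
    · change (starRingEnd ℂ) (x * y).snd =
        (starRingEnd ℂ) y.fst * (starRingEnd ℂ) x.snd +
          (starRingEnd ℂ) y.snd * (starRingEnd ℂ) x.fst
      simp only [TrivSqZeroExt.snd_mul, smul_eq_mul, MulOpposite.smul_eq_mul_unop,
        MulOpposite.unop_op, map_add, map_mul]
      ring
  star_add x y := TrivSqZeroExt.ext (map_add (starRingEnd ℂ) x.fst y.fst)
    (map_add (starRingEnd ℂ) x.snd y.snd)

theorem PosAppreciable.star_eq {x : DC} (hx : PosAppreciable x) : star x = x := by
  obtain ⟨⟨a, -, ha⟩, b, hb⟩ := hx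
  refine TrivSqZeroExt.ext ?_ ?_
  · change (starRingEnd ℂ) x.fst = x.fst
    rw [ha, Complex.conj_ofReal]
  · change (starRingEnd ℂ) x.snd = x.snd
    rw [hb, Complex.conj_ofReal]

theorem PosAppreciable.isUnit {x : DC} (hx : PosAppreciable x) : IsUnit x := by
  obtain ⟨⟨a, ha, hxa⟩, -⟩ := hx
  rw [TrivSqZeroExt.isUnit_iff_isUnit_fst, hxa, isUnit_iff_ne_zero]
  exact_mod_cast ha.ne'

/-- Sufficient condition for Hermitianness (ii). -/
theorem hermitian_of_mul_conjTranspose_ndmpi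
    {r s : ℕ}
    -- `Û`, a unitary matrix
    (U : Matrix (Fin r ⊕ Fin s) (Fin r ⊕ Fin s) DC)
    (hU₁ : U * Uᴴ = 1) (hU₂ : Uᴴ * U = 1)
    -- the blocks `K, L, M, N` forming a unitary block matrix
    (K : Matrix (Fin r) (Fin r) DC) (L : Matrix (Fin r) (Fin s) DC)
    (M : Matrix (Fin s) (Fin r) DC) (N : Matrix (Fin s) (Fin s) DC)
    (hW₁ : fromBlocks K L M N * (fromBlocks K L M N)ᴴ = 1)
    (hW₂ : (fromBlocks K L M N)ᴴ * fromBlocks K L M N = 1)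
    -- `Σ₁` diagonal with positive appreciable real dual diagonal entries
    (S₁ : Matrix (Fin r) (Fin r) DC) (d₁ : Fin r → DC)
    (hS₁ : S₁ = Matrix.diagonal d₁) (hd₁ : ∀ i, PosAppreciable (d₁ i))
    -- `Σ₂` diagonal with nonnegative infinitesimal real dual diagonal entries
    (S₂ : Matrix (Fin s) (Fin s) DC) (d₂ : Fin s → DC)
    (hS₂ : S₂ = Matrix.diagonal d₂) (hd₂ : ∀ i, NonnegInfinitesimal (d₂ i))
    -- the Hartwig–Spindelböck decomposition of `Â`
    (A : Matrix (Fin r ⊕ Fin s) (Fin r ⊕ Fin s) DC)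
    (hA : A = U * fromBlocks (S₁ * K) (S₁ * L) (S₂ * M) (S₂ * N) * Uᴴ)
    -- `Â^N`, the NDMPI of `Â`
    (AN : Matrix (Fin r ⊕ Fin s) (Fin r ⊕ Fin s) DC)
    (hAN : AN = U * fromBlocks (Kᴴ * S₁⁻¹) 0 (Lᴴ * S₁⁻¹) 0 * Uᴴ)
    (h : A * Aᴴ * AN = A) :
    Aᴴ = A := by
  let := dcStarRing
  have hdet : IsUnit S₁.det := by
    rw [hS₁, det_diagonal]
    exact IsUnit.prod_univ_iff.2 fun i => (hd₁ i).isUnit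
  have hS₁H : S₁ᴴ = S₁ := by
    rw [hS₁, diagonal_conjTranspose]
    exact congrArg diagonal (funext fun i => (hd₁ i).star_eq)
  have hAH : Aᴴ = U * (fromBlocks (S₁ * K) (S₁ * L) (S₂ * M) (S₂ * N))ᴴ * Uᴴ := by
    rw [hA]
    simp only [conjTranspose_mul, conjTranspose_conjTranspose, Matrix.mul_assoc]
  have hfactor : fromBlocks (S₁ * K) (S₁ * L) (S₂ * M) (S₂ * N) =
      fromBlocks S₁ 0 0 S₂ * fromBlocks K L M N := by
    simp [fromBlocks_multiply]
  have hBB : fromBlocks (S₁ * K) (S₁ * L) (S₂ * M) (S₂ * N) *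
      (fromBlocks (S₁ * K) (S₁ * L) (S₂ * M) (S₂ * N))ᴴ =
      fromBlocks (S₁ * S₁) 0 0 (S₂ * S₂ᴴ) := by
    rw [hfactor, conjTranspose_mul, Matrix.mul_assoc, ← Matrix.mul_assoc (fromBlocks K L M N),
      hW₁, Matrix.one_mul, fromBlocks_conjTranspose, fromBlocks_multiply, hS₁H]
    simp
  have hconj : ∀ X Y : Matrix (Fin r ⊕ Fin s) (Fin r ⊕ Fin s) DC,
      U * X * Uᴴ * (U * Y * Uᴴ) = U * (X * Y) * Uᴴ := fun X Y => by
    simp only [Matrix.mul_assoc]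
    rw [← Matrix.mul_assoc Uᴴ U, hU₂, Matrix.one_mul]
  have hcancel : ∀ X Y : Matrix (Fin r ⊕ Fin s) (Fin r ⊕ Fin s) DC,
      U * X * Uᴴ = U * Y * Uᴴ → X = Y := fun X Y hXY => by
    have := congrArg (fun Z => Uᴴ * Z * U) hXY
    simpa only [Matrix.mul_assoc, hU₂, Matrix.mul_one, ← Matrix.mul_assoc Uᴴ U,
      Matrix.one_mul] using this
  rw [hAH, hAN, hA, hconj, hconj, hBB, fromBlocks_multiply] at h
  obtain ⟨h₁, h₂, h₃, h₄⟩ := fromBlocks_inj.1 (hcancel _ _ h)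
  simp only [Matrix.mul_zero, Matrix.zero_mul, add_zero, zero_add] at h₁ h₂ h₃ h₄
  have hL : L = 0 := by
    rw [← Matrix.nonsing_inv_mul_cancel_left S₁ L hdet, ← h₂, Matrix.mul_zero]
  rw [hL, conjTranspose_zero, Matrix.zero_mul, Matrix.mul_zero] at h₃
  have hKK : K * Kᴴ = 1 := by
    rw [fromBlocks_conjTranspose, fromBlocks_multiply, ← fromBlocks_one] at hW₁
    simpa [hL] using (fromBlocks_inj.1 hW₁).1
  have hKK' : Kᴴ * K = 1 := mul_eq_one_comm.1 hKK
  have hcomm : S₁ * Kᴴ = K * S₁ := by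
    have h₅ : S₁ * (S₁ * Kᴴ) = S₁ * (K * S₁) := by
      rw [← Matrix.mul_assoc S₁ K, ← h₁]
      simp only [Matrix.mul_assoc, Matrix.nonsing_inv_mul S₁ hdet, Matrix.mul_one]
    rw [← Matrix.nonsing_inv_mul_cancel_left S₁ (S₁ * Kᴴ) hdet, h₅,
      Matrix.nonsing_inv_mul_cancel_left S₁ _ hdet]
  have hself : Kᴴ * S₁ = S₁ * K := by
    calc Kᴴ * S₁ = Kᴴ * (S₁ * Kᴴ) * K := by
          rw [Matrix.mul_assoc, Matrix.mul_assoc, hKK', Matrix.mul_one]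
      _ = S₁ * K := by rw [hcomm, ← Matrix.mul_assoc, hKK', Matrix.one_mul]
  rw [hAH, hA, ← h₂, ← h₃, ← h₄, fromBlocks_conjTranspose, conjTranspose_mul, hS₁H, hself]
  simp only [conjTranspose_zero]
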